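/- Fix 1 < p < q, let g_1 : ℝ → ℝ be defined by g_1(t) = |t|^{q−2}t if |t| ≤ 1 and g_1(t) = |t|^{p−2}t(log|t| + 1) if |t| > 1, set G_1(t) = ∫_0^t g_1(τ) dτ and σ_1(t) = g_1(t) t − p G_1(t). Then σ_1(t) = (1 − p/q)|t|^q for |t| ≤ 1 and σ_1(t) = |t|^p/p + 1 − 1/p − p/q for |t| > 1; moreover σ_1 is an even function, nondecreasing on [0,+∞). In particular σ_1(t_1) ≤ σ_1(t_2) whenever 0 ≤ t_1 ≤ t_2 or t_2 ≤ t_1 ≤ 0, so g_1 satisfies condition (G_3) with β ≡ 0. -/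

import Mathlib

/-- The model nonlinearity `g₁(t) = |t|^{q-2}t` for `|t| ≤ 1`,
`g₁(t) = |t|^{p-2}t(log|t| + 1)` for `|t| > 1`. -/
noncomputable def g1 (p q t : ℝ) : ℝ :=
  if |t| ≤ 1 then |t| ^ (q - 2) * t else |t| ^ (p - 2) * t * (Real.log |t| + 1)

/-- The primitive `G₁(t) = ∫₀ᵗ g₁(τ) dτ`. -/
noncomputable def G1 (p q t : ℝ) : ℝ := ∫ τ in (0:ℝ)..t, g1 p q τ

/-- `σ₁(t) = g₁(t) t - p G₁(t)`. -/
noncomputable def sigma1 (p q t : ℝ) : ℝ := g1 p q t * t - p * G1 p q t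

theorem g1_eqOn_Icc_zero_one {p q : ℝ} (hq : 1 < q) :
    Set.EqOn (g1 p q) (fun τ => τ ^ (q - 1)) (Set.Icc 0 1) := by
  rintro τ ⟨h0, h1⟩
  simp only [g1]
  rw [abs_of_nonneg h0, if_pos h1]
  rcases h0.eq_or_lt with rfl | h0
  · rw [mul_zero, Real.zero_rpow (by linarith)]
  · rw [← Real.rpow_add_one h0.ne']
    ring_nf

theorem g1_eqOn_Ici_one {p q : ℝ} :
    Set.EqOn (g1 p q) (fun τ => τ ^ (p - 1) * (Real.log τ + 1)) (Set.Ici 1) := by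
  intro τ (hτ : 1 ≤ τ)
  have h0 : 0 < τ := by linarith
  simp only [g1]
  rw [abs_of_pos h0]
  rcases hτ.eq_or_lt with rfl | hτ
  · simp
  · rw [if_neg hτ.not_ge, ← Real.rpow_add_one h0.ne']
    ring_nf

theorem g1_neg (p q t : ℝ) : g1 p q (-t) = -g1 p q t := by
  simp only [g1, abs_neg]
  split_ifs <;> ring

theorem G1_neg (p q t : ℝ) : G1 p q (-t) = G1 p q t := by
  have h := intervalIntegral.integral_comp_neg (a := 0) (b := t) (g1 p q)
  simp only [g1_neg, intervalIntegral.integral_neg, neg_zero] at h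
  rw [G1, G1, intervalIntegral.integral_symm, ← h, neg_neg]

theorem sigma1_neg (p q t : ℝ) : sigma1 p q (-t) = sigma1 p q t := by
  rw [sigma1, sigma1, g1_neg, G1_neg]
  ring

theorem sigma1_abs (p q t : ℝ) : sigma1 p q |t| = sigma1 p q t := by
  rcases abs_choice t with h | h <;> rw [h]
  exact sigma1_neg p q t

theorem G1_of_le_one {p q t : ℝ} (hq : 1 < q) (h0 : 0 ≤ t) (h1 : t ≤ 1) :
    G1 p q t = t ^ q / q := by
  have h : Set.EqOn (g1 p q) (fun τ => τ ^ (q - 1)) (Set.uIcc 0 t) := by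
    rw [Set.uIcc_of_le h0]
    exact (g1_eqOn_Icc_zero_one hq).mono (Set.Icc_subset_Icc_right h1)
  rw [G1, intervalIntegral.integral_congr h, integral_rpow (Or.inl (by linarith)),
    sub_add_cancel, Real.zero_rpow (by linarith), sub_zero]

theorem hasDerivAt_rpow_mul_log {p x : ℝ} (hp : p ≠ 0) (hx : 0 < x) :
    HasDerivAt (fun τ => τ ^ p * (Real.log τ + 1) / p - τ ^ p / p ^ 2)
      (x ^ (p - 1) * (Real.log x + 1)) x := by
  have h1 := Real.hasDerivAt_rpow_const (p := p) (Or.inl hx.ne')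
  have h2 := (Real.hasDerivAt_log hx.ne').add_const 1
  refine (((h1.mul h2).div_const p).sub (h1.div_const (p ^ 2))).congr_deriv ?_
  rw [Real.rpow_sub_one hx.ne']
  field_simp
  ring

theorem G1_of_one_le {p q t : ℝ} (hp : p ≠ 0) (hq : 1 < q) (ht : 1 ≤ t) :
    G1 p q t = 1 / q + t ^ p * (Real.log t + 1) / p - t ^ p / p ^ 2 - 1 / p + 1 / p ^ 2 := by
  have hsub : Set.uIcc 1 t ⊆ Set.Ici 1 := by
    rw [Set.uIcc_of_le ht]
    exact Set.Icc_subset_Ici_self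
  have hpos : ∀ x ∈ Set.uIcc 1 t, 0 < x := fun x hx => zero_lt_one.trans_le (hsub hx)
  have hcont : ContinuousOn (fun τ : ℝ => τ ^ (p - 1) * (Real.log τ + 1)) (Set.uIcc 1 t) :=
    (continuousOn_id.rpow_const fun x hx => Or.inl (hpos x hx).ne').mul
      ((Real.continuousOn_log.mono fun x hx => (hpos x hx).ne').add continuousOn_const)
  have heq := (g1_eqOn_Ici_one (p := p) (q := q)).mono hsub
  have hint₁ : IntervalIntegrable (g1 p q) MeasureTheory.volume 0 1 := by
    refine (ContinuousOn.congr ?_ ((g1_eqOn_Icc_zero_one hq).mono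
      (Set.uIcc_of_le zero_le_one).subset)).intervalIntegrable
    exact continuousOn_id.rpow_const fun x _ => Or.inr (by linarith)
  have hint₂ : IntervalIntegrable (g1 p q) MeasureTheory.volume 1 t :=
    (hcont.congr heq).intervalIntegrable
  have h := G1_of_le_one (p := p) hq zero_le_one le_rfl
  rw [G1, Real.one_rpow] at h
  rw [G1, ← intervalIntegral.integral_add_adjacent_intervals hint₁ hint₂, h,
    intervalIntegral.integral_congr heq,
    intervalIntegral.integral_eq_sub_of_hasDerivAt
      (fun x hx => hasDerivAt_rpow_mul_log hp (hpos x hx)) hcont.intervalIntegrable,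
    Real.log_one, Real.one_rpow]
  ring

theorem sigma1_of_abs_le_one {p q t : ℝ} (hq : 1 < q) (ht : |t| ≤ 1) :
    sigma1 p q t = (1 - p / q) * |t| ^ q := by
  rw [← sigma1_abs, sigma1, G1_of_le_one hq (abs_nonneg t) ht,
    g1_eqOn_Icc_zero_one hq ⟨abs_nonneg t, ht⟩]
  have h : |t| ^ (q - 1) * |t| = |t| ^ q := by
    rw [← Real.rpow_add_one' (abs_nonneg t) (by linarith), sub_add_cancel]
  rw [h]
  ring

theorem sigma1_of_one_le_abs {p q t : ℝ} (hp : p ≠ 0) (hq : 1 < q) (ht : 1 ≤ |t|) :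
    sigma1 p q t = |t| ^ p / p + 1 - 1 / p - p / q := by
  have hpos : 0 < |t| := zero_lt_one.trans_le ht
  rw [← sigma1_abs, sigma1, G1_of_one_le hp hq ht, g1_eqOn_Ici_one ht]
  simp only [Real.rpow_sub_one hpos.ne']
  field_simp
  ring

theorem monotoneOn_sigma1 {p q : ℝ} (hp : 0 < p) (hpq : p ≤ q) (hq : 1 < q) :
    MonotoneOn (sigma1 p q) (Set.Ici 0) := by
  have hq0 : 0 < q := hp.trans_le hpq
  have h₁ : MonotoneOn (sigma1 p q) (Set.Icc 0 1) := by
    rintro a ⟨ha, ha'⟩ b ⟨hb, hb'⟩ hab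
    rw [sigma1_of_abs_le_one hq (by rwa [abs_of_nonneg ha]),
      sigma1_of_abs_le_one hq (by rwa [abs_of_nonneg hb]), abs_of_nonneg ha, abs_of_nonneg hb]
    exact mul_le_mul_of_nonneg_left (Real.rpow_le_rpow ha hab hq0.le)
      (sub_nonneg.2 ((div_le_one hq0).2 hpq))
  have h₂ : MonotoneOn (sigma1 p q) (Set.Ici 1) := by
    intro a (ha : 1 ≤ a) b (hb : 1 ≤ b) hab
    have ha0 : 0 ≤ a := by linarith
    have hb0 : 0 ≤ b := by linarith
    rw [sigma1_of_one_le_abs hp.ne' hq (by rwa [abs_of_nonneg ha0]),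
      sigma1_of_one_le_abs hp.ne' hq (by rwa [abs_of_nonneg hb0]),
      abs_of_nonneg ha0, abs_of_nonneg hb0]
    gcongr
  rw [← Set.Icc_union_Ici_eq_Ici (zero_le_one (α := ℝ))]
  exact h₁.union_right h₂ (isGreatest_Icc zero_le_one) isLeast_Ici

/-- For `1 < p < q`: `σ₁(t) = (1 - p/q)|t|^q` for `|t| ≤ 1`,
`σ₁(t) = |t|^p/p + 1 - 1/p - p/q` for `|t| > 1`; `σ₁` is even and nondecreasing on
`[0,∞)`; in particular `σ₁(t₁) ≤ σ₁(t₂)` whenever `0 ≤ t₁ ≤ t₂` or `t₂ ≤ t₁ ≤ 0`,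
i.e. `g₁` satisfies condition `(G₃)` with `β ≡ 0`. -/
theorem sigma1_monotone (p q : ℝ) (hp : 1 < p) (hpq : p < q) :
    (∀ t : ℝ, |t| ≤ 1 → sigma1 p q t = (1 - p / q) * |t| ^ q) ∧
    (∀ t : ℝ, 1 < |t| → sigma1 p q t = |t| ^ p / p + 1 - 1 / p - p / q) ∧
    (∀ t : ℝ, sigma1 p q (-t) = sigma1 p q t) ∧
    MonotoneOn (sigma1 p q) (Set.Ici 0) ∧
    ∀ t₁ t₂ : ℝ, ((0 ≤ t₁ ∧ t₁ ≤ t₂) ∨ (t₂ ≤ t₁ ∧ t₁ ≤ 0)) →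
      sigma1 p q t₁ ≤ sigma1 p q t₂ := by
  have hq : 1 < q := hp.trans hpq
  have hp0 : 0 < p := zero_lt_one.trans hp
  have hmono := monotoneOn_sigma1 hp0 hpq.le hq
  refine ⟨fun t ht => sigma1_of_abs_le_one hq ht,
    fun t ht => sigma1_of_one_le_abs hp0.ne' hq ht.le, sigma1_neg p q, hmono, ?_⟩
  rintro t₁ t₂ (⟨h0, h⟩ | ⟨h, h0⟩)
  · exact hmono h0 (h0.trans h) h
  · rw [← sigma1_neg p q t₁, ← sigma1_neg p q t₂]
    exact hmono (neg_nonneg.2 h0) (neg_nonneg.2 (h.trans h0)) (neg_le_neg h)
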